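/- Four-pulse decomposition of commutator Hamiltonians (Lemma lem:depth4, restating Lemmas 7 and 9 of Clinton–Bausch–Cubitt): Let h₁, h₂ be d×d Hermitian matrices that anti-commute (h₁h₂ = −h₂h₁) and square to the identity (h₁² = h₂² = I), and set H := (1/(2i))·[h₁, h₂] = (1/(2i))·(h₁h₂ − h₂h₁). Then for every t with 0 ≤ t ≤ π/2 there exist t₁, t₂ ∈ ℝ with |t₁| + |t₂| ≤ √(2t) such that exp(i·t·H) = exp(i·t₁·h₁)·exp(i·t₂·h₂)·exp(i·t₂·h₁)·exp(i·t₁·h₂). -/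

import Mathlib

open scoped Matrix

lemma exp_invol_gen {A : Type*} [NormedRing A] [NormedAlgebra ℂ A] [CompleteSpace A]
    (a : A) (ha : a * a = 1) (θ : ℝ) :
    NormedSpace.exp ((Complex.I * (θ : ℂ)) • a) =
      ((Real.cos θ : ℝ) : ℂ) • (1 : A) + (Complex.I * ((Real.sin θ : ℝ) : ℂ)) • a := by
  have hc := (Complex.hasSum_cos' (θ : ℂ)).smul_const (1 : A)
  have hs := ((Complex.hasSum_sin' (θ : ℂ)).mul_left Complex.I).smul_const a
  have h2 : ∀ n : ℕ, a ^ (2 * n) = 1 := by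
    intro n
    rw [pow_mul, pow_two, ha, one_pow]
  have h3 : ∀ n : ℕ, a ^ (2 * n + 1) = a := by
    intro n
    rw [pow_succ, h2, one_mul]
  have hE := NormedSpace.exp_series_hasSum_exp' (𝕂 := ℂ) ((Complex.I * (θ : ℂ)) • a)
  refine hE.unique ?_
  push_cast
  refine HasSum.even_add_odd ?_ ?_
  · convert hc using 1
    funext n
    rw [smul_pow, h2, smul_smul, mul_comm Complex.I]
    congr 1
    rw [div_eq_inv_mul]
  · convert hs using 1
    funext n
    rw [smul_pow, h3, smul_smul, mul_comm Complex.I (θ : ℂ)]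
    congr 1
    field_simp

attribute [local instance] Matrix.linftyOpNormedRing Matrix.linftyOpNormedAlgebra in
lemma exp_invol {d : ℕ} (a : Matrix (Fin d) (Fin d) ℂ) (ha : a * a = 1) (θ : ℝ) :
    NormedSpace.exp ((Complex.I * (θ : ℂ)) • a) =
      ((Real.cos θ : ℝ) : ℂ) • (1 : Matrix (Fin d) (Fin d) ℂ)
        + (Complex.I * ((Real.sin θ : ℝ) : ℂ)) • a :=
  exp_invol_gen a ha θ

lemma bound_aux (t : ℝ) (ht0 : 0 ≤ t) (ht : t ≤ Real.pi / 2) :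
    Real.arccos (Real.cos t - Real.sin t) + Real.arctan (Real.sqrt (Real.sin (2 * t)))
      ≤ 2 * Real.sqrt (2 * t) := by
  let G : ℝ → ℝ := fun t => 2 * Real.sqrt (2 * t) -
    (Real.arccos (Real.cos t - Real.sin t) + Real.arctan (Real.sqrt (Real.sin (2 * t))))
  have hmono : MonotoneOn G (Set.Icc 0 (Real.pi / 2)) := by
    refine monotoneOn_of_hasDerivWithinAt_nonneg (f' := fun t =>
      2 * (2 / (2 * Real.sqrt (2 * t))) -
      ((Real.sin t + Real.cos t) / Real.sqrt (1 - (Real.cos t - Real.sin t) ^ 2) +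
        (1 / (1 + Real.sqrt (Real.sin (2 * t)) ^ 2)) *
          (2 * Real.cos (2 * t) / (2 * Real.sqrt (Real.sin (2 * t))))))
      (convex_Icc _ _) ?_ ?_ ?_
    · apply Continuous.continuousOn
      have := Real.continuous_arccos
      have := Real.continuous_arctan
      fun_prop
    · intro x hx
      rw [interior_Icc] at hx
      obtain ⟨hx0, hx1⟩ := hx
      have hs : 0 < Real.sin x := Real.sin_pos_of_pos_of_lt_pi hx0 (by linarith [Real.pi_pos])
      have hc : 0 < Real.cos x := Real.cos_pos_of_mem_Ioo ⟨by linarith, hx1⟩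
      have hsc := Real.sin_sq_add_cos_sq x
      have h2 : 0 < Real.sin (2 * x) := by rw [Real.sin_two_mul]; positivity
      have hs1 : Real.sin x < 1 := by nlinarith
      have hc1 : Real.cos x < 1 := by nlinarith
      have hid : HasDerivAt (fun y : ℝ => 2 * y) 2 x := by
        simpa using (hasDerivAt_id x).const_mul 2
      have d1 := ((hid.sqrt (by positivity)).const_mul 2)
      have d2 := (Real.hasDerivAt_arccos (x := Real.cos x - Real.sin x) (by linarith)
        (by linarith)).comp x ((Real.hasDerivAt_cos x).sub (Real.hasDerivAt_sin x))
      have d3 := ((hid.sin).sqrt h2.ne').arctan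
      have d := d1.sub (d2.add d3)
      refine HasDerivAt.hasDerivWithinAt ?_
      refine d.congr_deriv ?_
      ring
    · intro x hx
      rw [interior_Icc] at hx
      obtain ⟨hx0, hx1⟩ := hx
      have hs : 0 < Real.sin x := Real.sin_pos_of_pos_of_lt_pi hx0 (by linarith [Real.pi_pos])
      have hc : 0 < Real.cos x := Real.cos_pos_of_mem_Ioo ⟨by linarith, hx1⟩
      have hsc := Real.sin_sq_add_cos_sq x
      have h2 : 0 < Real.sin (2 * x) := by rw [Real.sin_two_mul]; positivity
      have hs1 : Real.sin x < 1 := by nlinarith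
      have hc1 : Real.cos x < 1 := by nlinarith
      have key : x ≤ 1 - (Real.cos x - Real.sin x) := by
        have hm : MonotoneOn (fun x => 1 - (Real.cos x - Real.sin x) - x)
            (Set.Icc 0 (Real.pi / 2)) := by
          refine monotoneOn_of_hasDerivWithinAt_nonneg
            (f' := fun x => Real.sin x + Real.cos x - 1) (convex_Icc _ _) ?_ ?_ ?_
          · apply Continuous.continuousOn
            fun_prop
          · intro y hy
            have := (((Real.hasDerivAt_cos y).sub (Real.hasDerivAt_sin y)).const_sub 1).sub
              (hasDerivAt_id y)
            refine HasDerivAt.hasDerivWithinAt ?_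
            refine this.congr_deriv ?_
            ring
          · intro y hy
            rw [interior_Icc] at hy
            obtain ⟨hy0, hy1⟩ := hy
            have hs : 0 < Real.sin y :=
              Real.sin_pos_of_pos_of_lt_pi hy0 (by linarith [Real.pi_pos])
            have hc : 0 < Real.cos y := Real.cos_pos_of_mem_Ioo ⟨by linarith, hy1⟩
            have hsc := Real.sin_sq_add_cos_sq y
            show 0 ≤ Real.sin y + Real.cos y - 1
            nlinarith
        have := hm (Set.left_mem_Icc.2 (by positivity)) (⟨hx0.le, hx1.le⟩) hx0.le
        simp at this
        linarith
      have e1 : 1 - (Real.cos x - Real.sin x) ^ 2 = Real.sin (2 * x) := by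
        rw [Real.sin_two_mul]; nlinarith
      have e2 : Real.cos (2 * x) =
          (Real.sin x + Real.cos x) * (Real.cos x - Real.sin x) := by
        rw [Real.cos_two_mul]; nlinarith
      have e3 : Real.sin (2 * x) = 2 * Real.sin x * Real.cos x := Real.sin_two_mul x
      show 0 ≤ 2 * (2 / (2 * Real.sqrt (2 * x))) -
        ((Real.sin x + Real.cos x) / Real.sqrt (1 - (Real.cos x - Real.sin x) ^ 2) +
        (1 / (1 + Real.sqrt (Real.sin (2 * x)) ^ 2)) *
          (2 * Real.cos (2 * x) / (2 * Real.sqrt (Real.sin (2 * x)))))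
      rw [e1, e2]
      have hw := Real.sqrt_pos.2 h2
      have hw2 := Real.sq_sqrt h2.le
      have hq : 0 < Real.sqrt (2 * x) := Real.sqrt_pos.2 (by linarith)
      have hq2 := Real.sq_sqrt (show 0 ≤ 2 * x by linarith)
      have hz1 : Real.cos x - Real.sin x < 1 := by linarith
      have hz2 : -1 < Real.cos x - Real.sin x := by linarith
      have hv : 0 < Real.sin x + Real.cos x := by linarith
      have hv2 : (Real.sin x + Real.cos x) ^ 2 = 2 - (Real.cos x - Real.sin x) ^ 2 := by
        nlinarith
      have hw3 : Real.sqrt (Real.sin (2 * x)) ^ 2 = 1 - (Real.cos x - Real.sin x) ^ 2 := by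
        rw [e1]; exact hw2
      clear hw2
      generalize Real.sqrt (Real.sin (2 * x)) = w at *
      generalize Real.sqrt (2 * x) = q at *
      generalize Real.cos x - Real.sin x = z at *
      generalize Real.sin x + Real.cos x = v at *
      have hb : v / w + 1 / (1 + w ^ 2) * (2 * (v * z) / (2 * w)) = (v ^ 2 + z) / (v * w) := by
        have : 1 + w ^ 2 = v ^ 2 := by linarith
        rw [this]
        field_simp
      rw [hb, sub_nonneg, show 2 * (2 / (2 * q)) = 2 / q by field_simp,
        div_le_div_iff₀ (by positivity) hq]
      refine (sq_le_sq₀ ?_ (by positivity)).1 ?_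
      · have : 0 < v ^ 2 + z := by nlinarith
        positivity
      have f1 : ((v ^ 2 + z) * q) ^ 2 = (2 - z ^ 2 + z) ^ 2 * (2 * x) := by
        rw [mul_pow, hq2, hv2]
      have f2 : (2 * (v * w)) ^ 2 = 4 * ((2 - z ^ 2) * (1 - z ^ 2)) := by
        rw [mul_pow, mul_pow, hw3, hv2]; norm_num
      rw [f1, f2]
      have f3 : (2 - z ^ 2 + z) ^ 2 * (2 * x) ≤ (2 - z ^ 2 + z) ^ 2 * (2 * (1 - z)) := by
        gcongr
      have f4 : 0 ≤ 2 * (1 - z) ^ 2 * (1 + z) * z ^ 2 := by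
        have : 0 < 1 + z := by linarith
        positivity
      nlinarith
  have := hmono (Set.left_mem_Icc.2 (by positivity)) ⟨ht0, ht⟩ ht0
  simp only [G] at this
  rw [mul_zero] at this
  norm_num at this
  rw [Real.sqrt_mul (by norm_num)]
  linarith

lemma prod_aux {d : ℕ} (a b : Matrix (Fin d) (Fin d) ℂ)
    (hab : b * a = -(a * b)) (ha : a * a = 1) (hb : b * b = 1) (c₁ s₁ c₂ s₂ : ℂ) :
    (c₁ • (1 : Matrix (Fin d) (Fin d) ℂ) + (Complex.I * s₁) • a) *
    (c₂ • (1 : Matrix (Fin d) (Fin d) ℂ) + (Complex.I * s₂) • b) *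
    (c₂ • (1 : Matrix (Fin d) (Fin d) ℂ) + (Complex.I * s₂) • a) *
    (c₁ • (1 : Matrix (Fin d) (Fin d) ℂ) + (Complex.I * s₁) • b) =
    ((c₁*c₂)^2 - 2*c₁*c₂*s₁*s₂ - (s₁*s₂)^2) • (1 : Matrix (Fin d) (Fin d) ℂ)
    + ((c₁*s₂)^2 - (s₁*c₂)^2 - 2*c₁*c₂*s₁*s₂) • (a * b)
    + (Complex.I * (c₁*c₂*(c₁*s₂+s₁*c₂) + s₁*s₂*(c₁*s₂-s₁*c₂))) • (a + b) := by
  have h1 : ∀ X, a * (a * X) = X := fun X => by rw [← mul_assoc, ha, one_mul]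
  have h2 : ∀ X, b * (b * X) = X := fun X => by rw [← mul_assoc, hb, one_mul]
  have h3 : ∀ X, b * (a * X) = -(a * (b * X)) := fun X => by
    rw [← mul_assoc, hab, neg_mul, mul_assoc]
  have hI := Complex.I_sq
  simp only [mul_add, add_mul, smul_mul_assoc, mul_smul_comm, mul_one, one_mul, mul_assoc,
    h1, h2, h3, hab, ha, hb, mul_neg, neg_mul, neg_neg]
  match_scalars <;> ring_nf <;> simp only [Complex.I_pow_four, hI, Complex.I_pow_three] <;> ring

/-- **Four-pulse decomposition of commutator Hamiltonians** (Lemma `lem:depth4`). -/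
theorem four_pulse_decomposition {d : ℕ} (h₁ h₂ : Matrix (Fin d) (Fin d) ℂ)
    (hh₁ : h₁.IsHermitian) (hh₂ : h₂.IsHermitian)
    (hanti : h₁ * h₂ = -(h₂ * h₁)) (hsq₁ : h₁ * h₁ = 1) (hsq₂ : h₂ * h₂ = 1)
    (H : Matrix (Fin d) (Fin d) ℂ)
    (hH : H = (2 * Complex.I)⁻¹ • (h₁ * h₂ - h₂ * h₁))
    (t : ℝ) (ht0 : 0 ≤ t) (ht : t ≤ Real.pi / 2) :
    ∃ t₁ t₂ : ℝ, |t₁| + |t₂| ≤ Real.sqrt (2 * t) ∧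
      NormedSpace.exp ((Complex.I * (t : ℂ)) • H) =
        NormedSpace.exp ((Complex.I * (t₁ : ℂ)) • h₁) *
        NormedSpace.exp ((Complex.I * (t₂ : ℂ)) • h₂) *
        NormedSpace.exp ((Complex.I * (t₂ : ℂ)) • h₁) *
        NormedSpace.exp ((Complex.I * (t₁ : ℂ)) • h₂) := by
  have hba : h₂ * h₁ = -(h₁ * h₂) := by rw [hanti, neg_neg]
  have hHe : H = (-Complex.I) • (h₁ * h₂) := by
    rw [hH, hba, sub_neg_eq_add, ← two_smul ℂ, smul_smul]
    congr 1
    field_simp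
    simp
  have hHH : H * H = 1 := by
    rw [hHe, smul_mul_smul_comm, mul_assoc, ← mul_assoc h₂, hba, neg_mul (h₁ * h₂), mul_neg h₁, mul_assoc h₁ h₂,
      hsq₂, mul_one, hsq₁]
    simp
  set w := Real.sqrt (Real.sin (2 * t)) with hw
  set z := Real.cos t - Real.sin t with hz
  have hs : 0 ≤ Real.sin t := Real.sin_nonneg_of_nonneg_of_le_pi ht0 (by linarith [Real.pi_pos])
  have hc : 0 ≤ Real.cos t := Real.cos_nonneg_of_mem_Icc ⟨by linarith [Real.pi_pos], ht⟩
  have hsc := Real.sin_sq_add_cos_sq t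
  have h2t : 0 ≤ Real.sin (2 * t) := by rw [Real.sin_two_mul]; positivity
  have hw0 : 0 ≤ w := Real.sqrt_nonneg _
  have hw2 : w ^ 2 = 2 * Real.sin t * Real.cos t := by
    rw [hw, Real.sq_sqrt h2t, Real.sin_two_mul]
  have hz1 : z ≤ 1 := by nlinarith
  have hz2 : -1 ≤ z := by nlinarith
  have hv : 0 < Real.sin t + Real.cos t := by nlinarith
  have hsq : Real.sqrt (1 + w ^ 2) = Real.sin t + Real.cos t := by
    rw [Real.sqrt_eq_iff_mul_self_eq (by positivity) hv.le]
    nlinarith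
  refine ⟨-(Real.arctan w / 2), Real.arccos z / 2, ?_, ?_⟩
  · rw [abs_neg, abs_of_nonneg (by have := Real.arctan_nonneg.2 hw0; positivity),
      abs_of_nonneg (by have := Real.arccos_nonneg z; positivity)]
    have := bound_aux t ht0 ht
    linarith
  · rw [exp_invol H hHH, exp_invol h₁ hsq₁, exp_invol h₂ hsq₂, exp_invol h₁ hsq₁,
      exp_invol h₂ hsq₂, prod_aux h₁ h₂ hba hsq₁ hsq₂]
    have a1 := Real.cos_arctan w
    have a2 := Real.sin_arctan w
    have a3 := Real.cos_arccos hz2 hz1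
    have a4 := Real.sin_arccos z
    have a5 : 1 - z ^ 2 = w ^ 2 := by rw [hw2, hz]; nlinarith
    rw [a5, Real.sqrt_sq hw0] at a4
    rw [hsq] at a1 a2
    set α := Real.arctan w / 2 with hα
    set β := Real.arccos z / 2 with hβ
    rw [show Real.arctan w = 2 * α by rw [hα]; ring] at a1 a2
    rw [show Real.arccos z = 2 * β by rw [hβ]; ring] at a3 a4
    have b1 := Real.sin_sq_add_cos_sq α
    have b2 := Real.sin_sq_add_cos_sq β
    have k1 := Real.cos_sq α
    have k2 := Real.cos_sq β
    have k3 := Real.sin_sq α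
    have k4 := Real.sin_sq β
    rw [Real.sin_two_mul] at a2 a4
    rw [a1] at k1
    rw [a3] at k2
    rw [Real.cos_neg, Real.sin_neg]
    have hi : (1 + w ^ 2) * (1 / (Real.sin t + Real.cos t)) = Real.sin t + Real.cos t := by
      have : 1 + w ^ 2 = (Real.sin t + Real.cos t) ^ 2 := by rw [hw2]; linear_combination -hsc
      rw [this]
      field_simp
    clear_value w z α β
    have E1 : (Real.cos α * Real.cos β)^2 - 2*Real.cos α*Real.cos β*(-Real.sin α)*Real.sin β
        - (-Real.sin α * Real.sin β)^2 = Real.cos t := by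
      have : 2*Real.cos α*Real.cos β*(-Real.sin α)*Real.sin β = -(2*Real.sin α*Real.cos α)*(2*Real.sin β*Real.cos β)/2 := by ring
      rw [this, a2, a4, mul_pow, mul_pow, neg_sq, k3, k4, k1, k2]
      linear_combination (1 / 2) * hi + (1 / 2) * hz
    have E2 : (Real.cos α * Real.sin β)^2 - (-Real.sin α * Real.cos β)^2
        - 2*Real.cos α*Real.cos β*(-Real.sin α)*Real.sin β = Real.sin t := by
      have : 2*Real.cos α*Real.cos β*(-Real.sin α)*Real.sin β = -(2*Real.sin α*Real.cos α)*(2*Real.sin β*Real.cos β)/2 := by ring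
      rw [this, a2, a4, mul_pow, mul_pow, neg_sq, k3, k4, k1, k2]
      linear_combination (1 / 2) * hi - (1 / 2) * hz
    have E3 : Real.cos α*Real.cos β*(Real.cos α*Real.sin β+(-Real.sin α)*Real.cos β)
        + (-Real.sin α)*Real.sin β*(Real.cos α*Real.sin β-(-Real.sin α)*Real.cos β) = 0 := by
      have : Real.cos α*Real.cos β*(Real.cos α*Real.sin β+(-Real.sin α)*Real.cos β)
        + (-Real.sin α)*Real.sin β*(Real.cos α*Real.sin β-(-Real.sin α)*Real.cos β)
        = (2*Real.sin β*Real.cos β) * (Real.cos α^2 - Real.sin α^2)/2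
          - (2*Real.sin α*Real.cos α) * (Real.sin β^2 + Real.cos β^2)/2 := by ring
      rw [this, a2, a4, b2, k3, k1]
      ring
    have F1 := congrArg (fun r : ℝ => (r : ℂ)) E1
    have F2 := congrArg (fun r : ℝ => (r : ℂ)) E2
    have F3 := congrArg (fun r : ℝ => (r : ℂ)) E3
    push_cast at F1 F2 F3 ⊢
    rw [F1, F2, F3, mul_zero, zero_smul, add_zero, hHe, smul_smul]
    congr 2
    linear_combination (-Complex.sin t) * Complex.I_sq
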